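/- arXiv:math/9802135 — 6 statements merged into one kernel-verified Lean document; each statement's English description precedes it below -/
import Mathlib

section
/- Let B be a Boolean algebra and a : ℕ → B a pattern-homogeneous sequence. Let n* ≥ 1, m* = (n*)², and define b_ν = ⊔_{l<n*} ⊓_{k<n*} a_{m*·ν + n*·l + k} for ν ∈ ℕ. Then for every n and every η : {0,…,n−1} → {0,1} with η ∈ Γ_n (i.e., ⊓_{i<n} a_i^{η(i)} = 0), it holds that ⊓_{i<n} b_i^{η(i)} = 0. -/
/-- `bexp b v` is `b^1 = b` if `v = true` and `b^0 = bᶜ` if `v = false`. -/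
def bexp {B : Type*} [BooleanAlgebra B] (b : B) (v : Bool) : B := if v then b else bᶜ

/-- A sequence `a : ℕ → B` is pattern-homogeneous if for every `n`, every
`η : {0,…,n−1} → {0,1}` and any two strictly increasing `n`-tuples of indices,
the corresponding meets `⊓_{k<n} a_{i_k}^{η(k)}` are simultaneously zero. -/
def PatternHomogeneous {B : Type*} [BooleanAlgebra B] (a : ℕ → B) : Prop :=
  ∀ (n : ℕ) (η : ℕ → Bool) (i j : ℕ → ℕ),
    StrictMonoOn i (Set.Iio n) → StrictMonoOn j (Set.Iio n) →
    (((Finset.range n).inf fun k => bexp (a (i k)) (η k)) = ⊥ ↔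
     ((Finset.range n).inf fun k => bexp (a (j k)) (η k)) = ⊥)

/-- `η ∈ Γ_n` (for the sequence `a`): the meet `⊓_{i<n} a_i^{η(i)}` is zero. -/
def InGamma {B : Type*} [BooleanAlgebra B] (a : ℕ → B) (n : ℕ) (η : ℕ → Bool) : Prop :=
  ((Finset.range n).inf fun i => bexp (a i) (η i)) = ⊥

theorem choice_aux {B : Type*} [BooleanAlgebra B] (x : ℕ → ℕ → B) (m n : ℕ) (hm : 0 < m) :
    ∀ c : B, (∀ f : ℕ → ℕ, (∀ i, f i < m) → Disjoint c ((Finset.range n).inf fun i => x i (f i))) →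
      Disjoint c ((Finset.range n).inf fun i => (Finset.range m).sup fun j => x i j) := by
  induction n with
  | zero =>
    intro c h
    simpa using h (fun _ => 0) (fun _ => hm)
  | succ n ih =>
    intro c h
    rw [Finset.range_add_one, Finset.inf_insert, ← disjoint_assoc, inf_comm,
      Finset.sup_inf_distrib_right, Finset.disjoint_sup_left]
    intro j hj
    apply ih
    intro f hf
    have h1 := h (fun i => if i = n then j else f i) (by
      intro i
      have := Finset.mem_range.1 hj
      split_ifs
      · exact this
      · exact hf i)
    rw [Finset.range_add_one, Finset.inf_insert, ← disjoint_assoc, inf_comm] at h1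
    have h2 : ((Finset.range n).inf fun i => x i (if i = n then j else f i)) =
        (Finset.range n).inf fun i => x i (f i) := by
      apply Finset.inf_congr rfl
      intro i hi
      rw [if_neg (Finset.mem_range.1 hi).ne]
    rw [h2] at h1
    simpa using h1

/-- Claim 2. -/
theorem stmt4 {B : Type*} [BooleanAlgebra B] (a : ℕ → B) (ha : PatternHomogeneous a)
    (nstar mstar : ℕ) (hn : 1 ≤ nstar) (hm : mstar = nstar ^ 2)
    (b : ℕ → B)
    (hb : ∀ ν, b ν = (Finset.range nstar).sup fun l => (Finset.range nstar).inf fun k =>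
        a (mstar * ν + nstar * l + k))
    (n : ℕ) (η : ℕ → Bool) (hη : InGamma a n η) :
    InGamma b n η := by
  have hm0 : 0 < mstar := by rw [hm]; positivity
  have key : ∀ ν, bexp (b ν) (η ν) ≤
      (Finset.range mstar).sup fun j => bexp (a (mstar * ν + j)) (η ν) := by
    intro ν
    rw [hb]
    cases hv : η ν with
    | true =>
      simp only [bexp, if_true]
      apply Finset.sup_le
      intro l hl
      have hl' := Finset.mem_range.1 hl
      refine (Finset.inf_le (Finset.mem_range.2 hn)).trans ?_
      have hlt : nstar * l ∈ Finset.range mstar := by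
        rw [Finset.mem_range, hm, pow_two]
        exact Nat.mul_lt_mul_of_pos_left hl' hn
      exact Finset.le_sup (f := fun j => a (mstar * ν + j)) hlt
    | false =>
      simp only [bexp, Bool.false_eq_true, if_false]
      rw [compl_le_iff_compl_le]
      refine le_trans ?_ (Finset.le_sup (Finset.mem_range.2 hn))
      apply Finset.le_inf
      intro k hk
      rw [compl_le_iff_compl_le]
      have hlt : k ∈ Finset.range mstar := by
        rw [Finset.mem_range] at *
        rw [hm]
        nlinarith
      exact Finset.le_sup (f := fun j => (a (mstar * ν + j))ᶜ) hlt
  have hd := choice_aux (fun ν j => bexp (a (mstar * ν + j)) (η ν)) mstar n hm0 ⊤ (by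
    intro f hf
    rw [top_disjoint]
    refine (ha n η (fun i => i) (fun i => mstar * i + f i) (fun _ _ _ _ h => h) ?_).1 hη
    intro p _ q _ hpq
    have h1 := hf p
    have h2 : mstar * (p + 1) ≤ mstar * q := Nat.mul_le_mul_left _ hpq
    dsimp only
    rw [Nat.mul_add] at h2
    omega)
  rw [top_disjoint] at hd
  unfold InGamma
  rw [eq_bot_iff, ← hd]
  exact Finset.inf_mono_fun fun i _ => key i
end

section
/- Let B be a Boolean algebra and a : ℕ → B a pattern-homogeneous sequence. Let n* ≥ 1 be such that every η ∈ Γ_n (for any n) has a subsequence η' of some length k < n* with η' ∈ Γ_k. Let m* = (n*)², and define b_ν = ⊔_{l<n*} ⊓_{k<n*} a_{m*·ν + n*·l + k} for ν ∈ ℕ. Suppose t ≥ 1, η ∈ Γ_n, 0 = k_0 < k_1 < … < k_t = n, and η is constant on each interval [k_i, k_{i+1}) for i < t; define ρ : {0,…,t−1} → {0,1} by ρ(i) = η(k_i). Then ⊓_{i<t} b_i^{ρ(i)} = 0. -/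
theorem aux_inf_not_mem {B ι : Type*} [BooleanAlgebra B] (I : Order.Ideal B) (hI : I.IsPrime)
    (s : Finset ι) (f : ι → B) (hf : ∀ i ∈ s, f i ∉ I) : s.inf f ∉ I := by
  classical
  induction s using Finset.induction_on with
  | empty =>
    simp only [Finset.inf_empty]
    intro h
    exact hI.1.ne_univ (Set.eq_univ_of_forall fun x => I.lower le_top h)
  | insert x s hx ih =>
    rw [Finset.inf_insert]
    intro h
    rcases hI.mem_or_mem h with h | h
    · exact hf x (by simp) h
    · exact ih (fun i hi => hf i (by simp [hi])) h

theorem aux_sup_mem {B ι : Type*} [BooleanAlgebra B] (I : Order.Ideal B)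
    (s : Finset ι) (f : ι → B) (hf : ∀ i ∈ s, f i ∈ I) : s.sup f ∈ I := by
  classical
  induction s using Finset.induction_on with
  | empty => simp
  | insert x s hx ih =>
    rw [Finset.sup_insert]
    exact I.sup_mem (hf x (by simp)) (ih (fun i hi => hf i (by simp [hi])))

theorem aux_exists_prime {B : Type*} [BooleanAlgebra B] (x : B) (hx : x ≠ ⊥) :
    ∃ I : Order.Ideal B, I.IsPrime ∧ x ∉ I := by
  obtain ⟨J, hJ, -, hd⟩ := DistribLattice.prime_ideal_of_disjoint_filter_ideal
    (F := Order.PFilter.principal x) (I := Order.Ideal.principal (⊥ : B)) (by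
      rw [Set.disjoint_left]
      intro y hy hy'
      simp only [SetLike.mem_coe, Order.PFilter.mem_principal, Order.Ideal.mem_principal] at hy hy'
      exact hx (le_bot_iff.1 (hy.trans hy')))
  refine ⟨J, hJ, fun h => ?_⟩
  exact Set.disjoint_left.1 hd (by simp : x ∈ (Order.PFilter.principal x : Set B)) h

theorem aux_block (k : ℕ → ℕ) (hk0 : k 0 = 0) (t j : ℕ) (hj : j < k t) :
    ∃ i < t, k i ≤ j ∧ j < k (i + 1) := by
  induction t with
  | zero => omega
  | succ t ih =>
    by_cases h : j < k t
    · obtain ⟨i, hi, h'⟩ := ih h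
      exact ⟨i, by omega, h'⟩
    · exact ⟨t, by omega, by omega, hj⟩

/-- Claim 3. -/
theorem stmt5 {B : Type*} [BooleanAlgebra B] (a : ℕ → B) (ha : PatternHomogeneous a)
    (nstar mstar : ℕ) (hn : 1 ≤ nstar) (hm : mstar = nstar ^ 2)
    -- every `η ∈ Γ_n` has a subsequence of some length `k < n*` lying in `Γ_k`
    (hsub : ∀ (n : ℕ) (η : ℕ → Bool), InGamma a n η →
      ∃ k, k < nstar ∧ ∃ h : ℕ → ℕ, StrictMonoOn h (Set.Iio k) ∧ (∀ i < k, h i < n) ∧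
        InGamma a k (fun i => η (h i)))
    (b : ℕ → B)
    (hb : ∀ ν, b ν = (Finset.range nstar).sup fun l => (Finset.range nstar).inf fun k =>
        a (mstar * ν + nstar * l + k))
    (t n : ℕ) (ht : 1 ≤ t) (η : ℕ → Bool) (hη : InGamma a n η)
    (k : ℕ → ℕ) (hk0 : k 0 = 0) (hkt : k t = n) (hkmono : StrictMonoOn k (Set.Iic t))
    -- `η` is constant on each interval `[k_i, k_{i+1})`
    (hconst : ∀ i < t, ∀ j, k i ≤ j → j < k (i + 1) → η j = η (k i)) :
    InGamma b t (fun i => η (k i)) := by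
  by_contra hne
  unfold InGamma at hne
  obtain ⟨I, hI, hxI⟩ := aux_exists_prime _ hne
  have hbI : ∀ i < t, bexp (b i) (η (k i)) ∉ I := fun i hi h =>
    hxI (I.lower (Finset.inf_le (f := fun i => bexp (b i) (η (k i))) (Finset.mem_range.2 hi)) h)
  have hcompl : ∀ z : B, z ∈ I → zᶜ ∉ I := by
    intro z hz hz'
    have h := I.sup_mem hz hz'
    rw [sup_compl_eq_top] at h
    exact hI.1.ne_univ (Set.eq_univ_of_forall fun x => I.lower le_top h)
  -- in every block there are `nstar` increasing indices with the right sign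
  have hidx : ∀ i, ∃ d : ℕ → ℕ, i < t → (∀ q < nstar, d q < mstar ∧
      bexp (a (mstar * i + d q)) (η (k i)) ∉ I) ∧ ∀ p q, p < q → q < nstar → d p < d q := by
    intro i
    by_cases hi : i < t
    swap
    · exact ⟨id, fun h => absurd h hi⟩
    have hbi := hbI i hi
    have hlt : ∀ l q, l < nstar → q < nstar → nstar * l + q < mstar := by
      intro l q hl hq
      rw [hm]
      nlinarith
    cases hv : η (k i) with
    | true =>
      simp only [hv, bexp, if_true] at hbi ⊢
      rw [hb] at hbi
      have : ∃ l < nstar, ((Finset.range nstar).inf fun k => a (mstar * i + nstar * l + k)) ∉ I := by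
        by_contra! hcon
        exact hbi (aux_sup_mem I _ _ fun l hl => hcon l (Finset.mem_range.1 hl))
      obtain ⟨l, hl, hlI⟩ := this
      refine ⟨fun q => nstar * l + q, fun _ => ⟨fun q hq => ⟨hlt l q hl hq, fun h => ?_⟩, ?_⟩⟩
      · refine hlI (I.lower (Finset.inf_le (Finset.mem_range.2 hq)) ?_)
        rwa [← add_assoc] at h
      · intro p q hpq _
        show nstar * l + p < nstar * l + q
        omega
    | false =>
      simp only [hv, bexp, Bool.false_eq_true, if_false] at hbi ⊢
      have hbm : b i ∈ I := (hI.mem_or_compl_mem).resolve_right hbi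
      have : ∀ l, ∃ q, l < nstar → q < nstar ∧ a (mstar * i + nstar * l + q) ∈ I := by
        intro l
        by_cases hl : l < nstar
        swap
        · exact ⟨0, fun h => absurd h hl⟩
        by_contra! hcon
        refine aux_inf_not_mem I hI (Finset.range nstar)
          (fun k => a (mstar * i + nstar * l + k))
          (fun q hq => (hcon q).2 (Finset.mem_range.1 hq)) (I.lower ?_ hbm)
        rw [hb]
        exact Finset.le_sup (f := fun l => (Finset.range nstar).inf fun k =>
          a (mstar * i + nstar * l + k)) (Finset.mem_range.2 hl)
      choose q hq using this
      refine ⟨fun l => nstar * l + q l, fun _ => ⟨fun l hl =>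
        ⟨hlt l _ hl (hq l hl).1, hcompl _ ?_⟩, ?_⟩⟩
      · rw [← add_assoc]
        exact (hq l hl).2
      · intro p r hpr hr
        have h1 := (hq p (hpr.trans hr)).1
        show nstar * p + q p < nstar * r + q r
        nlinarith
  choose d hd using hidx
  obtain ⟨r, hr, h, hmono, hhn, hG⟩ := hsub n η hη
  have hblock : ∀ p, ∃ i, p < r → i < t ∧ k i ≤ h p ∧ h p < k (i + 1) := by
    intro p
    by_cases hp : p < r
    · obtain ⟨i, hi⟩ := aux_block k hk0 t (h p) (by rw [hkt]; exact hhn p hp)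
      exact ⟨i, fun _ => hi⟩
    · exact ⟨0, fun h => absurd h hp⟩
  choose β hβ using hblock
  have hβmono : ∀ p q, p < q → q < r → β p ≤ β q := by
    intro p q hpq hq
    by_contra! hlt
    obtain ⟨h1, h2, h3⟩ := hβ p (hpq.trans hq)
    obtain ⟨h4, h5, h6⟩ := hβ q hq
    have h7 : k (β q + 1) ≤ k (β p) :=
      hkmono.monotoneOn (Set.mem_Iic.2 (by omega)) (Set.mem_Iic.2 (by omega)) (by omega)
    have h8 := hmono (Set.mem_Iio.2 (hpq.trans hq)) (Set.mem_Iio.2 hq) hpq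
    omega
  have hj : StrictMonoOn (fun p => mstar * β p + d (β p) p) (Set.Iio r) := by
    intro p hp q hq hpq
    simp only [Set.mem_Iio] at hp hq
    show mstar * β p + d (β p) p < mstar * β q + d (β q) q
    rcases (hβmono p q hpq hq).eq_or_lt with he | hlt
    · rw [he]
      have := (hd (β q) (hβ q hq).1).2 p q hpq (hq.trans hr)
      omega
    · have := (((hd (β p) (hβ p hp).1).1 p (hp.trans hr))).1
      nlinarith
  have hz := (ha r (fun i => η (h i)) (fun i => i) _ (fun _ _ _ _ h => h) hj).1 hG
  refine aux_inf_not_mem I hI (Finset.range r) _ ?_ (hz ▸ I.bot_mem)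
  intro p hp
  have hp := Finset.mem_range.1 hp
  obtain ⟨h1, h2, h3⟩ := hβ p hp
  have := ((hd (β p) h1).1 p (hp.trans hr)).2
  rwa [← hconst (β p) h1 (h p) h2 h3] at this
end

section
/- Let B be a Boolean algebra, a : ℕ → B a sequence, n* ≥ 1, m* = (n*)², and define b_ν = ⊔_{l<n*} ⊓_{k<n*} a_{m*·ν + n*·l + k} for ν ∈ ℕ. Suppose ρ : {0,…,t−1} → {0,1} satisfies ⊓_{i<t} b_i^{ρ(i)} = 0. Define ζ : {0,…,m*·t−1} → {0,1} so that ζ is constant with value ρ(i) on each interval [m*·i, m*·(i+1)) for i < t. Then ⊓_{j<m*·t} a_j^{ζ(j)} = 0. -/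
/-- Claim 4: if `⊓_{i<t} b_i^{ρ(i)} = 0` and `ζ` is constant with value `ρ(i)` on each
block `[m*·i, m*·(i+1))`, then `⊓_{j<m*·t} a_j^{ζ(j)} = 0`. -/
theorem stmt6 {B : Type*} [BooleanAlgebra B] (a : ℕ → B)
    (nstar mstar : ℕ) (hn : 1 ≤ nstar) (hm : mstar = nstar ^ 2)
    (b : ℕ → B)
    (hb : ∀ ν, b ν = (Finset.range nstar).sup fun l => (Finset.range nstar).inf fun k =>
        a (mstar * ν + nstar * l + k))
    (t : ℕ) (ρ : ℕ → Bool)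
    (hρ : ((Finset.range t).inf fun i => bexp (b i) (ρ i)) = ⊥)
    (ζ : ℕ → Bool)
    (hζ : ∀ i < t, ∀ j, mstar * i ≤ j → j < mstar * (i + 1) → ζ j = ρ i) :
    ((Finset.range (mstar * t)).inf fun j => bexp (a j) (ζ j)) = ⊥ := by
  rw [eq_bot_iff, ← hρ]
  refine Finset.le_inf fun i hi => ?_
  have hi' : i < t := Finset.mem_range.mp hi
  have key : ∀ l < nstar, ∀ k < nstar,
      ((Finset.range (mstar * t)).inf fun j => bexp (a j) (ζ j))
        ≤ bexp (a (mstar * i + nstar * l + k)) (ρ i) := by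
    intro l hl k hk
    have h1 : nstar * l + k < mstar := by
      have : nstar * (l + 1) ≤ nstar * nstar := Nat.mul_le_mul_left _ hl
      rw [hm, pow_two]
      rw [Nat.mul_add] at this
      omega
    have h2 : mstar * i + nstar * l + k < mstar * (i + 1) := by
      rw [Nat.mul_add]
      omega
    have h3 : mstar * (i + 1) ≤ mstar * t := Nat.mul_le_mul_left _ hi'
    rw [← hζ i hi' (mstar * i + nstar * l + k) (by omega) h2]
    exact Finset.inf_le (f := fun j => bexp (a j) (ζ j))
      (Finset.mem_range.mpr (lt_of_lt_of_le h2 h3))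
  cases h : ρ i with
  | true =>
    simp only [h, bexp, if_true] at key ⊢
    rw [hb]
    exact le_trans (Finset.le_inf fun k hk => key 0 hn k (Finset.mem_range.mp hk))
      (Finset.le_sup (f := fun l => (Finset.range nstar).inf fun k =>
        a (mstar * i + nstar * l + k)) (Finset.mem_range.mpr hn))
  | false =>
    simp only [h, bexp, Bool.false_eq_true, if_false] at key ⊢
    rw [hb]
    apply le_compl_comm.mp
    refine Finset.sup_le fun l hl => ?_
    exact le_trans (Finset.inf_le (Finset.mem_range.mpr hn))
      (le_compl_comm.mp (key l (Finset.mem_range.mp hl) 0 hn))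
end

section
/- Let B be a Boolean algebra, λ an infinite cardinal, and (a_ν : ν < λ) a free sequence in B. Let n ≥ 1 and let (β_ξ : ξ < λ) be a strictly increasing sequence of ordinals below λ (equivalently, a strictly increasing sequence indexed by sufficiently many ordinals). Define b_ν = ⊔_{k<n} ⊓_{l<n} a_{β_{n²·ν+n·k+l}}. Then for all ν < μ (with all required indices defined), b_ν ≠ b_μ; in particular the sequence (b_ν) is injective. -/
open Ordinal

/-- If `(a_ν : ν < λ)` is a free sequence in a Boolean algebra `B`, `n ≥ 1`, and
`(β_ξ : ξ < λ)` is a strictly increasing sequence of ordinals below `λ`, then the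
elements `b_ν = ⊔_{k<n} ⊓_{l<n} a_{β_{n²·ν+n·k+l}}` are pairwise distinct. -/
theorem stmt7 (B : Type*) [BooleanAlgebra B] (lam : Cardinal)
    (hlam : Cardinal.aleph0 ≤ lam)
    (a : Ordinal → B)
    -- `(a ν : ν < λ)` is a free sequence in `B`
    (hfree : ∀ Γ Δ : Finset Ordinal,
      (↑Γ : Set Ordinal) ⊆ Set.Iio lam.ord → (↑Δ : Set Ordinal) ⊆ Set.Iio lam.ord →
      (∀ α ∈ Γ, ∀ β ∈ Δ, α < β) →
      (Γ.inf fun α => (a α)ᶜ) ⊓ (Δ.inf fun β => a β) ≠ ⊥)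
    (n : ℕ) (hn : 1 ≤ n)
    (β : Ordinal → Ordinal)
    (hβlt : ∀ ξ, ξ < lam.ord → β ξ < lam.ord)
    (hβmono : ∀ ξ η, ξ < η → η < lam.ord → β ξ < β η)
    (b : Ordinal → B)
    (hb : ∀ ν, b ν = (Finset.range n).sup fun k => (Finset.range n).inf fun l =>
        a (β ((n : Ordinal) ^ 2 * ν + (n : Ordinal) * (k : Ordinal) + (l : Ordinal)))) :
    ∀ ν μ, ν < μ → μ < lam.ord → b ν ≠ b μ := by
  intro ν μ hνμ hμ heq
  have homega : ω ≤ lam.ord := by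
    rw [← Cardinal.ord_aleph0]
    exact Cardinal.ord_le_ord.2 hlam
  have hnat : ∀ m : ℕ, (m : Ordinal) < lam.ord := fun m =>
    lt_of_lt_of_le (Ordinal.natCast_lt_omega0 m) homega
  have hadd := Ordinal.isPrincipal_add_ord hlam
  have hmul := Ordinal.isPrincipal_mul_ord hlam
  have hidx : ∀ ρ, ρ < lam.ord → ∀ k l : ℕ,
      (n : Ordinal) ^ 2 * ρ + (n : Ordinal) * (k : Ordinal) + (l : Ordinal) < lam.ord := by
    intro ρ hρ k l
    have h2 : (n : Ordinal) ^ 2 < lam.ord := by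
      have := hnat (n ^ 2)
      exact_mod_cast this
    exact hadd (hadd (hmul h2 hρ) (hmul (hnat n) (hnat k))) (hnat l)
  have hlt : ∀ k < n, ∀ l < n, ∀ k' l' : ℕ,
      (n : Ordinal) ^ 2 * ν + (n : Ordinal) * (k : Ordinal) + (l : Ordinal) <
      (n : Ordinal) ^ 2 * μ + (n : Ordinal) * (k' : Ordinal) + (l' : Ordinal) := by
    intro k hk l hl k' l'
    have hm : n * k + l < n ^ 2 := by nlinarith
    have h1 : (n : Ordinal) * (k : Ordinal) + (l : Ordinal) < (n : Ordinal) ^ 2 := by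
      exact_mod_cast hm
    calc _ = (n : Ordinal) ^ 2 * ν + ((n : Ordinal) * (k : Ordinal) + (l : Ordinal)) :=
          add_assoc _ _ _
      _ < (n : Ordinal) ^ 2 * ν + (n : Ordinal) ^ 2 := by gcongr
      _ = (n : Ordinal) ^ 2 * Order.succ ν := (Ordinal.mul_succ _ _).symm
      _ ≤ (n : Ordinal) ^ 2 * μ := by
          gcongr
          exact Order.succ_le_of_lt hνμ
      _ ≤ _ := by
          rw [add_assoc]
          exact le_self_add
  classical
  let S (ρ : Ordinal) : Finset Ordinal := (Finset.range n ×ˢ Finset.range n).image fun p =>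
    β ((n : Ordinal) ^ 2 * ρ + (n : Ordinal) * (p.1 : Ordinal) + (p.2 : Ordinal))
  have hS : ∀ ρ, ρ < lam.ord → (↑(S ρ) : Set Ordinal) ⊆ Set.Iio lam.ord := by
    intro ρ hρ x hx
    obtain ⟨p, -, rfl⟩ := Finset.mem_image.1 (Finset.mem_coe.1 hx)
    exact hβlt _ (hidx ρ hρ _ _)
  have hmem : ∀ ρ, ∀ k < n, ∀ l < n,
      β ((n : Ordinal) ^ 2 * ρ + (n : Ordinal) * (k : Ordinal) + (l : Ordinal)) ∈ S ρ := by
    intro ρ k hk l hl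
    exact Finset.mem_image.2 ⟨(k, l), by simp [hk, hl], rfl⟩
  refine hfree (S ν) (S μ) (hS ν (hνμ.trans hμ)) (hS μ hμ) ?_ ?_
  · intro x hx y hy
    obtain ⟨p, hp, rfl⟩ := Finset.mem_image.1 hx
    obtain ⟨q, -, rfl⟩ := Finset.mem_image.1 hy
    simp only [Finset.mem_product, Finset.mem_range] at hp
    exact hβmono _ _ (hlt _ hp.1 _ hp.2 _ _) (hidx μ hμ _ _)
  · have h1 : ((S ν).inf fun α => (a α)ᶜ) ≤ (b ν)ᶜ := by
      rw [le_compl_comm, hb]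
      refine Finset.sup_le fun k hk => ?_
      rw [Finset.mem_range] at hk
      refine (Finset.inf_le (Finset.mem_range.2 hk)).trans ?_
      rw [le_compl_comm]
      exact Finset.inf_le (f := fun α => (a α)ᶜ) (hmem ν k hk k hk)
    have h2 : ((S μ).inf fun α => a α) ≤ b μ := by
      rw [hb]
      refine le_trans ?_ (Finset.le_sup (f := fun k : ℕ => (Finset.range n).inf fun l : ℕ =>
        a (β ((n : Ordinal) ^ 2 * μ + (n : Ordinal) * (k : Ordinal) + (l : Ordinal))))
        (Finset.mem_range.2 (show 0 < n from hn)))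
      refine Finset.le_inf fun l hl => ?_
      exact Finset.inf_le (f := fun α => a α) (hmem μ 0 hn l (Finset.mem_range.1 hl))
    rw [← le_bot_iff]
    refine (inf_le_inf h1 h2).trans ?_
    rw [heq, compl_inf_self]
end

section
/- Let B be a Boolean algebra and a : ℕ → B a pattern-homogeneous sequence. Let n* ≥ 1, m* = (n*)², and define b_ν = ⊔_{l<n*} ⊓_{k<n*} a_{m*·ν + n*·l + k} for ν ∈ ℕ. Then the sequence b : ℕ → B is again pattern-homogeneous: for every n, every η : {0,…,n−1} → {0,1}, and any two strictly increasing tuples ν_0 < … < ν_{n−1} and μ_0 < … < μ_{n−1} of natural numbers, ⊓_{i<n} b_{ν_i}^{η(i)} = 0 if and only if ⊓_{i<n} b_{μ_i}^{η(i)} = 0. -/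
theorem bexp_disj {B : Type*} [BooleanAlgebra B] (x : B) {u v : Bool} (h : u ≠ v) :
    bexp x u ⊓ bexp x v = ⊥ := by
  cases u <;> cases v <;> simp_all [bexp]

theorem exists_pattern {B : Type*} [BooleanAlgebra B] (x : B) (hx : x ≠ ⊥) (f : ℕ → B) (N : ℕ) :
    ∃ θ : ℕ → Bool, x ⊓ ((Finset.range N).inf fun k => bexp (f k) (θ k)) ≠ ⊥ := by
  induction N with
  | zero => exact ⟨fun _ => true, by simpa using hx⟩
  | succ N ih =>
    obtain ⟨θ, hθ⟩ := ih
    set y := x ⊓ ((Finset.range N).inf fun k => bexp (f k) (θ k)) with hy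
    have key : ∃ v, y ⊓ bexp (f N) v ≠ ⊥ := by
      by_contra! hcon
      apply hθ
      have h1 := hcon true
      have h2 := hcon false
      simp only [bexp] at h1 h2
      have : y = y ⊓ f N ⊔ y ⊓ (f N)ᶜ := by rw [← inf_sup_left]; simp
      simp only [if_true, Bool.false_eq_true, if_false] at h1 h2
      rw [this, h1, h2, sup_bot_eq]
    obtain ⟨v, hv⟩ := key
    refine ⟨Function.update θ N v, ?_⟩
    rw [Finset.range_add_one, Finset.inf_insert]
    have : ((Finset.range N).inf fun k => bexp (f k) (Function.update θ N v k))
        = (Finset.range N).inf fun k => bexp (f k) (θ k) := by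
      apply Finset.inf_congr rfl
      intro k hk
      have : k ≠ N := by have := Finset.mem_range.1 hk; omega
      simp [Function.update_of_ne this]
    rw [this, Function.update_self, inf_comm (bexp (f N) v), ← inf_assoc]
    exact hv

theorem le_bexp_sup_inf {B : Type*} [BooleanAlgebra B] (c : B) (m : ℕ) (g : ℕ → ℕ → B)
    (θ : ℕ → ℕ → Bool) (h : ∀ l < m, ∀ k < m, c ≤ bexp (g l k) (θ l k)) (v : Bool)
    (hv : v = true ↔ ∃ l < m, ∀ k < m, θ l k = true) :
    c ≤ bexp ((Finset.range m).sup fun l => (Finset.range m).inf fun k => g l k) v := by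
  cases v with
  | true =>
    obtain ⟨l, hl, hk⟩ := hv.1 rfl
    simp only [bexp, if_true]
    refine le_trans ?_ (Finset.le_sup (Finset.mem_range.2 hl))
    refine Finset.le_inf fun k hk' => ?_
    have := h l hl k (Finset.mem_range.1 hk')
    rw [hk k (Finset.mem_range.1 hk')] at this
    simpa [bexp] using this
  | false =>
    have hv' : ¬ ∃ l < m, ∀ k < m, θ l k = true := fun hh => by simpa using hv.2 hh
    push Not at hv'
    simp only [bexp, Bool.false_eq_true, if_false]
    rw [le_compl_comm]
    refine Finset.sup_le fun l hl => ?_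
    obtain ⟨k, hk, hne⟩ := hv' l (Finset.mem_range.1 hl)
    refine (Finset.inf_le (Finset.mem_range.2 hk)).trans ?_
    have := h l (Finset.mem_range.1 hl) k hk
    rw [ne_eq, Bool.not_eq_true] at hne
    rw [hne] at this
    rw [le_compl_comm]
    simpa [bexp] using this

theorem strictMonoOn_blocks (m n : ℕ) (hm : 0 < m) (i : ℕ → ℕ) (hi : StrictMonoOn i (Set.Iio n)) :
    StrictMonoOn (fun k => m * i (k / m) + k % m) (Set.Iio (n * m)) := by
  intro x hx y hy hxy
  have hx' : x / m < n := (Nat.div_lt_iff_lt_mul hm).2 hx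
  have hy' : y / m < n := (Nat.div_lt_iff_lt_mul hm).2 hy
  have hle : x / m ≤ y / m := Nat.div_le_div_right hxy.le
  have ex := Nat.div_add_mod x m
  have ey := Nat.div_add_mod y m
  show m * i (x / m) + x % m < m * i (y / m) + y % m
  rcases hle.eq_or_lt with h | h
  · rw [h] at ex ⊢
    omega
  · have h1 : i (x / m) + 1 ≤ i (y / m) := hi hx' hy' h
    have h2 := Nat.mul_le_mul_left m h1
    have h3 := Nat.mod_lt x hm
    rw [Nat.mul_add] at h2
    omega

theorem stmt8_aux {B : Type*} [BooleanAlgebra B] (a : ℕ → B) (ha : PatternHomogeneous a)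
    (nstar mstar : ℕ) (hn : 1 ≤ nstar) (hm : mstar = nstar ^ 2)
    (b : ℕ → B)
    (hb : ∀ ν, b ν = (Finset.range nstar).sup fun l => (Finset.range nstar).inf fun k =>
        a (mstar * ν + nstar * l + k)) (n : ℕ) (η : ℕ → Bool) (i j : ℕ → ℕ)
    (hi : StrictMonoOn i (Set.Iio n)) (hj : StrictMonoOn j (Set.Iio n))
    (h : ((Finset.range n).inf fun k => bexp (b (j k)) (η k)) = ⊥) :
    ((Finset.range n).inf fun k => bexp (b (i k)) (η k)) = ⊥ := by
  classical
  by_contra hx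
  have hmpos : 0 < mstar := by rw [hm]; positivity
  obtain ⟨θ, hθ⟩ := exists_pattern _ hx (fun k => a (mstar * i (k / mstar) + k % mstar)) (n * mstar)
  let P : ℕ → Prop := fun r => ∃ l < nstar, ∀ k < nstar, θ (mstar * r + (nstar * l + k)) = true
  have key : ∀ i : ℕ → ℕ, ∀ r < n, ((Finset.range (n * mstar)).inf fun k =>
      bexp (a (mstar * i (k / mstar) + k % mstar)) (θ k)) ≤ bexp (b (i r)) (decide (P r)) := by
    intro i r hr
    rw [hb]
    apply le_bexp_sup_inf _ nstar (fun l k => a (mstar * i r + nstar * l + k))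
      (fun l k => θ (mstar * r + (nstar * l + k)))
    · intro l hl k hk
      have hlt : nstar * l + k < mstar := by
        have := Nat.mul_le_mul_left nstar (Nat.succ_le_of_lt hl)
        rw [Nat.succ_eq_add_one, Nat.mul_add] at this
        rw [hm, sq]; omega
      have hmem : mstar * r + (nstar * l + k) ∈ Finset.range (n * mstar) := by
        have := Nat.mul_le_mul_left mstar (Nat.succ_le_of_lt hr)
        rw [Nat.succ_eq_add_one, Nat.mul_add] at this
        rw [Finset.mem_range, Nat.mul_comm n]; omega
      refine (Finset.inf_le hmem).trans ?_
      rw [Nat.mul_add_div hmpos, Nat.div_eq_of_lt hlt, Nat.mul_add_mod, Nat.mod_eq_of_lt hlt]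
      simp [add_assoc]
    · simp [P]
  have hP : ∀ r < n, decide (P r) = η r := by
    intro r hr
    by_contra hne
    apply hθ
    rw [eq_bot_iff, ← bexp_disj (b (i r)) hne, inf_comm]
    exact inf_le_inf (key i r hr) (Finset.inf_le (Finset.mem_range.2 hr))
  have h1 := (ha (n * mstar) θ _ _ (strictMonoOn_blocks mstar n hmpos i hi)
    (strictMonoOn_blocks mstar n hmpos j hj)).2
  apply hθ
  rw [h1, inf_bot_eq]
  rw [eq_bot_iff, ← h]
  refine Finset.le_inf fun r hr => ?_
  rw [← hP r (Finset.mem_range.1 hr)]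
  exact key j r (Finset.mem_range.1 hr)

/-- The derived sequence `b_ν = ⊔_{l<n*} ⊓_{k<n*} a_{m*·ν+n*·l+k}` of a
pattern-homogeneous sequence is again pattern-homogeneous. -/
theorem stmt8 {B : Type*} [BooleanAlgebra B] (a : ℕ → B) (ha : PatternHomogeneous a)
    (nstar mstar : ℕ) (hn : 1 ≤ nstar) (hm : mstar = nstar ^ 2)
    (b : ℕ → B)
    (hb : ∀ ν, b ν = (Finset.range nstar).sup fun l => (Finset.range nstar).inf fun k =>
        a (mstar * ν + nstar * l + k)) :
    PatternHomogeneous b := by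
  intro n η i j hi hj
  exact ⟨stmt8_aux a ha nstar mstar hn hm b hb n η j i hj hi,
    stmt8_aux a ha nstar mstar hn hm b hb n η i j hi hj⟩
end

section
/- Let B be a Boolean algebra and a : ℕ → B a pattern-homogeneous sequence. Let n* ≥ 1 be such that every η ∈ Γ_n (for any n) has a subsequence η' of some length k < n* with η' ∈ Γ_k. Let m* = (n*)² and define b_ν = ⊔_{l<n*} ⊓_{k<n*} a_{m*·ν + n*·l + k}. Suppose k* ≥ 1 is minimal such that there exists ρ* : {0,…,k*−1} → {0,1} with ⊓_{i<k*} b_i^{ρ*(i)} = 0. Then ρ* alternates, i.e., ρ*(i+1) ≠ ρ*(i) for every i < k*−1. -/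
/-- A two-valued valuation on a Boolean algebra. -/
structure IsVal {B : Type*} [BooleanAlgebra B] (f : B → Prop) : Prop where
  bot : ¬ f ⊥
  top : f ⊤
  inf : ∀ x y, f (x ⊓ y) ↔ f x ∧ f y
  sup : ∀ x y, f (x ⊔ y) ↔ f x ∨ f y

theorem exists_val {B : Type*} [BooleanAlgebra B] (x : B) (hx : x ≠ ⊥) :
    ∃ f : B → Prop, IsVal f ∧ f x := by
  obtain ⟨J, hJ, -, hd⟩ := DistribLattice.prime_ideal_of_disjoint_filter_ideal
    (F := Order.PFilter.principal x) (I := Order.Ideal.principal (⊥ : B)) (by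
      rw [Set.disjoint_left]
      intro y hy hy'
      have h1 : x ≤ y := by simpa using hy
      have h2 : y ≤ ⊥ := Order.Ideal.mem_principal.1 hy'
      exact hx (le_bot_iff.1 (h1.trans h2)))
  have hxJ : x ∉ J := fun h => Set.disjoint_left.1 hd (by simp) h
  refine ⟨fun y => y ∉ J, ⟨?_, ?_, ?_, ?_⟩, hxJ⟩
  · simp
  · exact fun h => hxJ (J.lower le_top h)
  · intro u v
    refine ⟨fun h => ⟨fun hu => h (J.lower inf_le_left hu), fun hv => h (J.lower inf_le_right hv)⟩, ?_⟩
    rintro ⟨hu, hv⟩ h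
    rcases hJ.mem_or_mem h with h | h
    · exact hu h
    · exact hv h
  · intro u v
    rw [Order.Ideal.sup_mem_iff]
    tauto

theorem IsVal.compl {B : Type*} [BooleanAlgebra B] {f : B → Prop} (hf : IsVal f) (x : B) :
    f xᶜ ↔ ¬ f x := by
  have h1 := hf.inf x xᶜ
  have h2 := hf.sup x xᶜ
  rw [inf_compl_self] at h1
  rw [sup_compl_eq_top] at h2
  have := hf.bot
  have := hf.top
  tauto

theorem IsVal.bexp {B : Type*} [BooleanAlgebra B] {f : B → Prop} (hf : IsVal f) (x : B) (v : Bool) :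
    f (bexp x v) ↔ (f x ↔ v = true) := by
  cases v <;> simp [_root_.bexp, hf.compl]

theorem IsVal.finf {B : Type*} [BooleanAlgebra B] {f : B → Prop} (hf : IsVal f) (n : ℕ) (g : ℕ → B) :
    f ((Finset.range n).inf g) ↔ ∀ i < n, f (g i) := by
  induction n with
  | zero => simp [hf.top]
  | succ n ih =>
    rw [Finset.range_add_one, Finset.inf_insert, hf.inf, ih]
    simp only [Nat.lt_succ_iff_lt_or_eq]
    grind

theorem IsVal.fsup {B : Type*} [BooleanAlgebra B] {f : B → Prop} (hf : IsVal f) (n : ℕ) (g : ℕ → B) :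
    f ((Finset.range n).sup g) ↔ ∃ i < n, f (g i) := by
  induction n with
  | zero => simp [hf.bot]
  | succ n ih =>
    rw [Finset.range_add_one, Finset.sup_insert, hf.sup, ih]
    simp only [Nat.lt_succ_iff_lt_or_eq]
    grind

theorem inf_eq_bot_iff {B : Type*} [BooleanAlgebra B] (n : ℕ) (g : ℕ → B) (η : ℕ → Bool) :
    ((Finset.range n).inf fun k => bexp (g k) (η k)) = ⊥ ↔
      ∀ f : B → Prop, IsVal f → ¬ ∀ k < n, (f (g k) ↔ η k = true) := by
  constructor
  · intro h f hf hk
    apply hf.bot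
    rw [← h, hf.finf]
    exact fun i hi => (hf.bexp _ _).2 (hk i hi)
  · intro h
    by_contra hne
    obtain ⟨f, hf, hx⟩ := exists_val _ hne
    rw [hf.finf] at hx
    exact h f hf fun k hk => (hf.bexp _ _).1 (hx k hk)

/-- If `k* ≥ 1` is minimal such that `⊓_{i<k*} b_i^{ρ*(i)} = 0` for some `ρ*`,
then `ρ*` alternates. -/
theorem stmt9 {B : Type*} [BooleanAlgebra B] (a : ℕ → B) (ha : PatternHomogeneous a)
    (nstar mstar : ℕ) (hn : 1 ≤ nstar) (hm : mstar = nstar ^ 2)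
    -- every `η ∈ Γ_n` has a subsequence of some length `k < n*` lying in `Γ_k`
    (hsub : ∀ (n : ℕ) (η : ℕ → Bool), InGamma a n η →
      ∃ k, k < nstar ∧ ∃ h : ℕ → ℕ, StrictMonoOn h (Set.Iio k) ∧ (∀ i < k, h i < n) ∧
        InGamma a k (fun i => η (h i)))
    (b : ℕ → B)
    (hb : ∀ ν, b ν = (Finset.range nstar).sup fun l => (Finset.range nstar).inf fun k =>
        a (mstar * ν + nstar * l + k))
    (kstar : ℕ) (hk1 : 1 ≤ kstar) (ρstar : ℕ → Bool)
    (hρ : InGamma b kstar ρstar)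
    (hmin : ∀ k < kstar, ∀ ρ : ℕ → Bool, ¬ InGamma b k ρ) :
    ∀ i, i + 1 < kstar → ρstar (i + 1) ≠ ρstar i := by
  classical
  intro i hi heq
  have hbv : ∀ f : B → Prop, IsVal f → ∀ ν, f (b ν) ↔
      ∃ l < nstar, ∀ k < nstar, f (a (mstar * ν + nstar * l + k)) := by
    intro f hf ν
    rw [hb, hf.fsup]
    simp only [hf.finf]
  -- positions inside a block
  have hpos : ∀ l < nstar, ∀ k < nstar, nstar * l + k < mstar := by
    intro l hl k hk
    rw [hm]
    nlinarith
  have h1 := hmin (kstar - 1) (by omega) (fun j => if j ≤ i then ρstar j else ρstar (j + 1))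
  rw [InGamma, inf_eq_bot_iff] at h1
  push Not at h1
  obtain ⟨f, hf, hfb⟩ := h1
  obtain ⟨p, hp1, hp2, hpm⟩ : ∃ p : ℕ → ℕ,
      (∀ s < nstar, mstar * i ≤ p s ∧ p s < mstar * i + mstar) ∧
      (∀ s < nstar, (f (a (p s)) ↔ ρstar i = true)) ∧
      (∀ s t, s < t → t < nstar → p s < p t) := by
    have hbi := hfb i (by omega)
    rw [hbv f hf] at hbi
    simp only [le_refl, if_true] at hbi
    by_cases hc : ρstar i = true
    · obtain ⟨l, hl, hlk⟩ := hbi.2 hc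
      refine ⟨fun s => mstar * i + nstar * l + s, ?_, ?_, ?_⟩
      · intro s hs
        have := hpos l hl s hs
        dsimp only
        omega
      · intro s hs
        simp [hlk s hs, hc]
      · intro s t hst ht
        dsimp only
        omega
    · have hbi' := mt hbi.1 hc
      push Not at hbi'
      choose! q hq1 hq2 using hbi'
      refine ⟨fun s => mstar * i + nstar * s + q s, ?_, ?_, ?_⟩
      · intro s hs
        have := hpos s hs _ (hq1 s hs)
        dsimp only
        omega
      · intro s hs
        simp [hq2 s hs, hc]
      · intro s t hst ht
        have := hq1 s (by omega)
        have : nstar * (s + 1) ≤ nstar * t := Nat.mul_le_mul_left _ hst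
        dsimp only
        rw [mul_add] at this
        omega
  set η : ℕ → Bool := fun t =>
    if t < mstar * i then decide (f (a t)) else if t < mstar * i + 2 * mstar then ρstar i
      else decide (f (a (t - mstar))) with hη
  have hnot : ¬ InGamma a (mstar * kstar) η := by
    intro hG
    obtain ⟨q, hq, h, hmono, -, hG'⟩ := hsub _ _ hG
    set g : ℕ → ℕ := fun s =>
      if h s < mstar * i then h s else if h s < mstar * i + 2 * mstar then p s
        else h s - mstar with hg
    have hgm : StrictMonoOn g (Set.Iio q) := by
      intro s hs t ht hst
      have hh := hmono hs ht hst
      simp only [Set.mem_Iio] at hs ht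
      have e1 := hp1 s (by omega)
      have e2 := hp1 t (by omega)
      have e3 := hpm s t hst (by omega)
      simp only [hg]
      split_ifs <;> omega
    have h2 := (ha q (fun s => η (h s)) (fun s => s) g
      (fun _ _ _ _ h => h) hgm).1 hG'
    rw [inf_eq_bot_iff] at h2
    refine h2 f hf fun s hs => ?_
    have e1 := hp2 s (by omega)
    simp only [hg, hη]
    split_ifs <;> simp [e1]
  rw [InGamma, inf_eq_bot_iff] at hnot
  push Not at hnot
  obtain ⟨f', hf', hfa⟩ := hnot
  rw [InGamma, inf_eq_bot_iff] at hρ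
  refine hρ f' hf' fun j hj => ?_
  rw [hbv f' hf']
  have hjk : mstar * (j + 1) ≤ mstar * kstar := Nat.mul_le_mul_left _ hj
  rw [mul_add, mul_one] at hjk
  have key : ∀ P : ℕ → ℕ → Prop,
      (∀ l < nstar, ∀ k < nstar, (f' (a (mstar * j + nstar * l + k)) ↔ P l k)) →
      ((∃ l < nstar, ∀ k < nstar, f' (a (mstar * j + nstar * l + k))) ↔
        ∃ l < nstar, ∀ k < nstar, P l k) := by
    intro P hP
    constructor
    · rintro ⟨l, hl, h⟩
      exact ⟨l, hl, fun k hk => (hP l hl k hk).1 (h k hk)⟩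
    · rintro ⟨l, hl, h⟩
      exact ⟨l, hl, fun k hk => (hP l hl k hk).2 (h k hk)⟩
  rcases lt_or_ge j i with hji | hji
  · have hle : mstar * (j + 1) ≤ mstar * i := Nat.mul_le_mul_left _ hji
    rw [mul_add, mul_one] at hle
    have hbj := hfb j (by omega)
    rw [if_pos hji.le, hbv f hf] at hbj
    rw [← hbj]
    apply key
    intro l hl k hk
    have := hpos l hl k hk
    rw [hfa _ (by omega)]
    simp only [hη]
    rw [if_pos (by omega)]
    simp
  rcases lt_or_ge j (i + 2) with hji2 | hji2
  · have hρj : ρstar j = ρstar i := by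
      rcases (by omega : j = i ∨ j = i + 1) with rfl | rfl
      · rfl
      · exact heq
    have hle : mstar * i ≤ mstar * j := Nat.mul_le_mul_left _ hji
    have hle2 : mstar * j ≤ mstar * (i + 1) := Nat.mul_le_mul_left _ (by omega)
    rw [mul_add, mul_one] at hle2
    rw [hρj, key (fun _ _ => ρstar i = true)]
    · constructor
      · rintro ⟨l, hl, h⟩
        exact h 0 hn
      · exact fun h => ⟨0, hn, fun _ _ => h⟩
    intro l hl k hk
    have := hpos l hl k hk
    rw [hfa _ (by omega)]
    simp only [hη]
    rw [if_neg (by omega), if_pos (by omega)]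
  · obtain ⟨j', rfl⟩ : ∃ j', j = j' + 1 := ⟨j - 1, by omega⟩
    have hle : mstar * (i + 2) ≤ mstar * (j' + 1) := Nat.mul_le_mul_left _ hji2
    have hbj := hfb j' (by omega)
    rw [if_neg (by omega), hbv f hf] at hbj
    rw [← hbj]
    apply key
    intro l hl k hk
    have := hpos l hl k hk
    rw [mul_add] at hle
    have hs : mstar * (j' + 1) = mstar * j' + mstar := by ring
    rw [hfa _ (by omega)]
    simp only [hη]
    rw [if_neg (by omega), if_neg (by omega)]
    have : mstar * (j' + 1) + nstar * l + k - mstar = mstar * j' + nstar * l + k := by omega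
    rw [this]
    simp
end
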